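/- Let β, γ ∈ R₊ⁿ and let P = {a ∈ R̄₊ⁿ : ⟨a,β⟩ ≥ 1} and Q = {a ∈ R̄₊ⁿ : ⟨a,γ⟩ ≥ 1} be cosimplices. Then the copolar sum P ⊕ Q = (P° + Q°)° is again a cosimplex: P ⊕ Q = {a ∈ R̄₊ⁿ : ⟨a, β + γ⟩ ≥ 1}. Equivalently, the k-th vertex of P ⊕ Q is rₖ eₖ with 1/rₖ = 1/pₖ + 1/qₖ, where pₖ eₖ = (1/βₖ)eₖ and qₖ eₖ = (1/γₖ)eₖ are the k-th vertices of P and Q. -/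

import Mathlib

open Set MeasureTheory Pointwise

noncomputable section

abbrev En (n : ℕ) := EuclideanSpace ℝ (Fin n)

/-- Standard inner product on ℝⁿ. -/
def dotp {n : ℕ} (x y : En n) : ℝ := ∑ i, x i * y i

/-- Closed positive orthant R̄₊ⁿ. -/
def posOrthantCl (n : ℕ) : Set (En n) := {x | ∀ i, 0 ≤ x i}
/-- Open positive orthant R₊ⁿ. -/
def posOrthantOp (n : ℕ) : Set (En n) := {x | ∀ i, 0 < x i}
/-- Closed negative orthant R̄₋ⁿ. -/
def negOrthantCl (n : ℕ) : Set (En n) := {x | ∀ i, x i ≤ 0}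
/-- Open negative orthant R₋ⁿ. -/
def negOrthantOp (n : ℕ) : Set (En n) := {x | ∀ i, x i < 0}

/-- Copolar A° = {x : ⟨x,y⟩ ≤ −1 for all y ∈ A}. -/
def copolar {n : ℕ} (A : Set (En n)) : Set (En n) := {x | ∀ y ∈ A, dotp x y ≤ -1}

/-- Membership in C₊: closed convex subset of R̄₊ⁿ with A + R₊ⁿ ⊆ A. -/
def memCplus {n : ℕ} (A : Set (En n)) : Prop :=
  IsClosed A ∧ Convex ℝ A ∧ A ⊆ posOrthantCl n ∧ A + posOrthantOp n ⊆ A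

/-- Membership in C₋: closed convex subset of R̄₋ⁿ with A + R₋ⁿ ⊆ A. -/
def memCminus {n : ℕ} (A : Set (En n)) : Prop :=
  IsClosed A ∧ Convex ℝ A ∧ A ⊆ negOrthantCl n ∧ A + negOrthantOp n ⊆ A

/-- Membership in CC₊: member of C₊ with bounded complement in R̄₊ⁿ. -/
def memCCplus {n : ℕ} (P : Set (En n)) : Prop :=
  memCplus P ∧ Bornology.IsBounded (posOrthantCl n \ P)

/-- Membership in UC₋: nonempty member of C₋ contained in s* + R̄₋ⁿ for some s* ∈ R₋ⁿ. -/
def memUCminus {n : ℕ} (L : Set (En n)) : Prop :=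
  L.Nonempty ∧ memCminus L ∧ ∃ s ∈ negOrthantOp n, L ⊆ s +ᵥ negOrthantCl n

/-- Support function of a set, with values in EReal. -/
def suppFn {n : ℕ} (A : Set (En n)) (x : En n) : EReal := ⨆ y ∈ A, ((dotp x y : ℝ) : EReal)

/-- Legendre transform of an EReal-valued function. -/
def legendre {n : ℕ} (f : En n → EReal) (y : En n) : EReal :=
  ⨆ x, ((dotp x y : ℝ) : EReal) - f x
lemma dotp_le_dotp_left {n : ℕ} {x x' y : En n} (hx : ∀ i, x i ≤ x' i)
    (hy : y ∈ posOrthantCl n) : dotp x y ≤ dotp x' y :=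
  Finset.sum_le_sum fun i _ => mul_le_mul_of_nonneg_right (hx i) (hy i)

lemma dotp_comm {n : ℕ} (x y : En n) : dotp x y = dotp y x := by
  simp [dotp, mul_comm]

lemma dotp_neg_left {n : ℕ} (x y : En n) : dotp (-x) y = -dotp x y := by
  simp [dotp]

lemma dotp_add_left {n : ℕ} (x y z : En n) : dotp (x + y) z = dotp x z + dotp y z := by
  simp [dotp, add_mul, Finset.sum_add_distrib]

lemma dotp_single_left {n : ℕ} (k : Fin n) (t : ℝ) (x : En n) :
    dotp (EuclideanSpace.single k t) x = t * x k := by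
  simp [dotp]

/-- The copolar of a cosimplex is a translate of the closed negative orthant. -/
lemma copolar_cosimplex {n : ℕ} {β : En n} (hβ : β ∈ posOrthantOp n) :
    copolar {a ∈ posOrthantCl n | 1 ≤ dotp a β} = {x | ∀ i, x i ≤ (-β) i} := by
  ext x
  refine ⟨fun hx k => ?_, fun hx y hy => ?_⟩
  · have hk := hβ k
    have h := hx (EuclideanSpace.single k (β k)⁻¹) ⟨fun i => ?_, ?_⟩
    · rw [dotp_comm, dotp_single_left, inv_mul_le_iff₀ hk] at h
      simpa using h
    · by_cases hik : i = k <;> simp [hik, hk.le]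
    · rw [dotp_single_left, inv_mul_cancel₀ hk.ne']
  · have h := dotp_le_dotp_left hx hy.1
    rw [dotp_neg_left, dotp_comm β] at h
    linarith [hy.2]

/-- The copolar of a translate of the closed negative orthant is a cosimplex. -/
lemma copolar_translate_negOrthant {n : ℕ} (β : En n) :
    copolar {x | ∀ i, x i ≤ (-β) i} = {a ∈ posOrthantCl n | 1 ≤ dotp a β} := by
  ext a
  refine ⟨fun ha => ?_, fun ha y hy => ?_⟩
  · refine ⟨fun k => ?_, ?_⟩
    · by_contra! hk
      have key : ∀ t : ℝ, t ≤ 0 → -dotp β a + t * a k ≤ -1 := fun t ht => by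
        rw [← dotp_neg_left, ← dotp_single_left, ← dotp_add_left, dotp_comm]
        refine ha _ fun i => ?_
        by_cases hik : i = k <;> simp [hik, ht]
      have h := key (|dotp β a| / a k) (div_nonpos_of_nonneg_of_nonpos (abs_nonneg _) hk.le)
      rw [div_mul_cancel₀ _ hk.ne] at h
      linarith [le_abs_self (dotp β a)]
    · have h := ha (-β) fun i => le_rfl
      rw [dotp_comm, dotp_neg_left, dotp_comm] at h
      linarith
  · have h := dotp_le_dotp_left hy ha.1
    rw [dotp_neg_left, dotp_comm, dotp_comm β] at h
    linarith [ha.2]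

/-- Minkowski sums of translates of the closed negative orthant. -/
lemma translate_negOrthant_add {n : ℕ} (β γ : En n) :
    {x : En n | ∀ i, x i ≤ (-β) i} + {x : En n | ∀ i, x i ≤ (-γ) i}
      = {x | ∀ i, x i ≤ (-(β + γ)) i} := by
  ext x
  refine ⟨?_, fun hx => ⟨x + γ, fun i => ?_, -γ, fun i => le_rfl, by simp⟩⟩
  · rintro ⟨y, hy, z, hz, rfl⟩ i
    have h := add_le_add (hy i) (hz i)
    simp only [PiLp.add_apply, PiLp.neg_apply] at h ⊢
    linarith
  · have h := hx i
    simp only [PiLp.add_apply, PiLp.neg_apply] at h ⊢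
    linarith

/-- The copolar sum of the cosimplices with vectors β and γ is the
cosimplex with vector β + γ; equivalently the k-th vertices satisfy
1/rₖ = 1/pₖ + 1/qₖ where pₖ = 1/βₖ, qₖ = 1/γₖ, rₖ = 1/(βₖ+γₖ). -/
theorem copolarSum_cosimplex (n : ℕ) (hn : 1 ≤ n) (β γ : En n)
    (hβ : β ∈ posOrthantOp n) (hγ : γ ∈ posOrthantOp n) :
    copolar (copolar {a ∈ posOrthantCl n | 1 ≤ dotp a β}
        + copolar {a ∈ posOrthantCl n | 1 ≤ dotp a γ})
      = {a ∈ posOrthantCl n | 1 ≤ dotp a (β + γ)} ∧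
    ∀ k : Fin n, 1 / (1 / (β k + γ k)) = 1 / (1 / β k) + 1 / (1 / γ k) := by
  refine ⟨?_, fun k => by simp only [one_div_one_div]⟩
  rw [copolar_cosimplex hβ, copolar_cosimplex hγ, translate_negOrthant_add,
    copolar_translate_negOrthant]
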